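/- Let p, q, s ∈ [1,∞] and A = (α₀, α_∞), B = (β₀, β_∞) ∈ ℝ² be such that (p,q,A) and (p,s,B) are admissible Lorentz–Zygmund parameters, with p < ∞. If β_∞ + max{1/s − 1/q, 0} < α_∞, then lim_{a→∞} sup{ ‖f^* χ_{(a,∞)}‖_{L^{p,s,B}(0,∞)} : f measurable on (0,∞), ‖f‖_{L^{p,q,A}(0,∞)} ≤ 1 } = 0. -/

import Mathlib

open MeasureTheory Set Filter Topology
open scoped ENNReal NNReal

noncomputable section

/-- The nonincreasing rearrangement of an `ℝ≥0∞`-valued function with respect to `μ`: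
`f^*(t) = inf {λ : μ({f > λ}) ≤ t}`. -/
def rearr {α : Type*} [MeasurableSpace α] (μ : Measure α) (f : α → ℝ≥0∞) (t : ℝ) : ℝ≥0∞ :=
  sInf {l : ℝ≥0∞ | μ {x | l < f x} ≤ ENNReal.ofReal t}

/-- Lebesgue measure on `(0,∞)`. -/
def μI : Measure ℝ := volume.restrict (Set.Ioi (0 : ℝ))

/-- `ℓ(t) = 1 + |log t|`. -/
def ell (t : ℝ) : ℝ := 1 + |Real.log t|

/-- The broken-logarithm power `ℓ^A(t)`, equal to `ℓ(t)^{α₀}` for `t ≤ 1` and to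
`ℓ(t)^{α_∞}` for `t > 1`, where `A = (α₀, α_∞)`. -/
def ellA (A : ℝ × ℝ) (t : ℝ) : ℝ := if t ≤ 1 then ell t ^ A.1 else ell t ^ A.2

/-- The `L^q(0,∞)` norm (with `q ∈ [1,∞]`) of a nonnegative function. -/
def lqNorm (q : ℝ≥0∞) (g : ℝ → ℝ≥0∞) : ℝ≥0∞ :=
  if q = ∞ then essSup g μI
  else (∫⁻ t in Set.Ioi (0 : ℝ), g t ^ q.toReal) ^ q.toReal⁻¹

/-- The Lorentz–Zygmund functional
`‖f‖_{L^{p,q,A}(0,∞)} = ‖ t^{1/p - 1/q} ℓ^A(t) f^*(t) ‖_{L^q(0,∞)}`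
(with the conventions `1/∞ = 0`). -/
def lzNorm (p q : ℝ≥0∞) (A : ℝ × ℝ) (f : ℝ → ℝ≥0∞) : ℝ≥0∞ :=
  lqNorm q fun t => ENNReal.ofReal (t ^ (p.toReal⁻¹ - q.toReal⁻¹) * ellA A t) * rearr μI f t

/-- Admissibility of Lorentz–Zygmund parameters: the functional `‖·‖_{L^{p,q,A}}` is
equivalent to a rearrangement-invariant norm. -/
def LZAdmissible (p q : ℝ≥0∞) (A : ℝ × ℝ) : Prop :=
  (p = 1 ∧ q = 1 ∧ 0 ≤ A.1 ∧ A.2 ≤ 0) ∨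
  (1 < p ∧ p < ∞ ∧ 1 ≤ q) ∨
  (p = ∞ ∧ 1 ≤ q ∧ q < ∞ ∧ A.1 + q.toReal⁻¹ < 0) ∨
  (p = ∞ ∧ q = ∞ ∧ A.1 ≤ 0)


lemma one_le_ell (t : ℝ) : 1 ≤ ell t := by unfold ell; linarith [abs_nonneg (Real.log t)]

lemma ell_pos (t : ℝ) : 0 < ell t := lt_of_lt_of_le one_pos (one_le_ell t)

lemma ell_of_one_le {t : ℝ} (ht : 1 ≤ t) : ell t = 1 + Real.log t := by
  unfold ell; rw [abs_of_nonneg (Real.log_nonneg ht)]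

lemma ell_mono {u t : ℝ} (hu : 1 ≤ u) (h : u ≤ t) : ell u ≤ ell t := by
  rw [ell_of_one_le hu, ell_of_one_le (hu.trans h)]
  linarith [Real.log_le_log (by linarith) h]

lemma ell_inv (t : ℝ) : ell t⁻¹ = ell t := by
  unfold ell; rw [Real.log_inv, abs_neg]

lemma ell_mul_le {x y : ℝ} (hx : 0 < x) (hy : 0 < y) : ell (x * y) ≤ ell x * ell y := by
  unfold ell; rw [Real.log_mul hx.ne' hy.ne']
  nlinarith [abs_add_le (Real.log x) (Real.log y), abs_nonneg (Real.log x),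
    abs_nonneg (Real.log y), mul_nonneg (abs_nonneg (Real.log x)) (abs_nonneg (Real.log y))]

lemma ell_growth (b : ℝ) {ε : ℝ} (hε : 0 < ε) :
    ∃ C : ℝ, 0 < C ∧ ∀ x, 1 ≤ x → ell x ^ b ≤ C * x ^ ε := by
  rcases le_or_gt b 0 with hb | hb
  · refine ⟨1, one_pos, fun x hx => ?_⟩
    rw [one_mul]
    exact (Real.rpow_le_one_of_one_le_of_nonpos (one_le_ell x) hb).trans
      (Real.one_le_rpow hx hε.le)
  · have hδ : 0 < ε / b := div_pos hε hb
    refine ⟨(1 + 1 / (ε / b)) ^ b, by positivity, fun x hx => ?_⟩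
    have h0 : 0 < x := by linarith
    have h1 : ell x ≤ (1 + 1 / (ε / b)) * x ^ (ε / b) := by
      rw [ell_of_one_le hx]
      have := Real.log_le_rpow_div h0.le hδ
      have h2 := Real.one_le_rpow hx hδ.le
      have : x ^ (ε / b) / (ε / b) = 1 / (ε / b) * x ^ (ε / b) := by ring
      linarith
    calc ell x ^ b ≤ ((1 + 1 / (ε / b)) * x ^ (ε / b)) ^ b :=
          Real.rpow_le_rpow (ell_pos x).le h1 hb.le
      _ = _ := by
          rw [Real.mul_rpow (by positivity) (by positivity), ← Real.rpow_mul h0.le,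
            div_mul_cancel₀ _ hb.ne']

lemma ell_ratio (β : ℝ) {t a : ℝ} (ht : 0 < t) (ha : 0 < a) :
    ell t ^ β ≤ ell (a / t) ^ |β| * ell a ^ β := by
  have h1 : ell t ≤ ell (a / t) * ell a := by
    have : t = (a / t)⁻¹ * a := by field_simp
    calc ell t = ell ((a / t)⁻¹ * a) := by rw [← this]
      _ ≤ ell (a/t)⁻¹ * ell a := ell_mul_le (by positivity) ha
      _ = _ := by rw [ell_inv]
  have h2 : ell a ≤ ell (a / t) * ell t := by
    have : a = (a / t) * t := by field_simp
    calc ell a = ell ((a / t) * t) := by rw [← this]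
      _ ≤ _ := ell_mul_le (by positivity) ht
  have p1 := ell_pos t
  have p2 := ell_pos a
  have p3 := ell_pos (a/t)
  rcases le_or_gt 0 β with hb | hb
  · rw [abs_of_nonneg hb, ← Real.mul_rpow p3.le p2.le]
    exact Real.rpow_le_rpow p1.le h1 hb
  · rw [abs_of_neg hb]
    have h3 := Real.rpow_le_rpow p2.le h2 (neg_pos.2 hb).le
    rw [Real.mul_rpow p3.le p1.le, Real.rpow_neg p2.le, Real.rpow_neg p1.le] at h3
    have q1 : 0 < ell t ^ β := Real.rpow_pos_of_pos p1 _
    have q2 : 0 < ell a ^ β := Real.rpow_pos_of_pos p2 _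
    field_simp at h3
    linarith

lemma ell_near (B : ℝ × ℝ) {ε : ℝ} (hε : 0 < ε) :
    ∃ C : ℝ, 0 < C ∧ ∀ a, 1 ≤ a → ∀ t, 0 < t → t ≤ a →
      t ^ ε * ellA B t ≤ C * (a ^ ε * ell a ^ B.2) := by
  obtain ⟨C1, hC1, h1⟩ := ell_growth B.1 hε
  obtain ⟨C2, hC2, h2⟩ := ell_growth (-B.2) hε
  obtain ⟨C3, hC3, h3⟩ := ell_growth |B.2| hε
  refine ⟨C1 * C2 + C3, by positivity, fun a ha t ht hta => ?_⟩
  have ha0 : 0 < a := by linarith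
  have pa : 0 < ell a ^ B.2 := Real.rpow_pos_of_pos (ell_pos a) _
  have pae : 0 < a ^ ε := Real.rpow_pos_of_pos ha0 _
  have pte : 0 < t ^ ε := Real.rpow_pos_of_pos ht _
  unfold ellA
  split_ifs with h
  · have e1 := h1 t⁻¹ ((one_le_inv₀ ht).2 h)
    rw [ell_inv, Real.inv_rpow ht.le] at e1
    have e1' : t ^ ε * ell t ^ B.1 ≤ C1 := by
      calc t ^ ε * ell t ^ B.1 ≤ t ^ ε * (C1 * (t ^ ε)⁻¹) := by gcongr
        _ = C1 := by field_simp
    have e2 := h2 a ha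
    rw [Real.rpow_neg (ell_pos a).le] at e2
    have e2' : 1 ≤ C2 * (a ^ ε * ell a ^ B.2) := by
      field_simp at e2; linarith
    calc t ^ ε * ell t ^ B.1 ≤ C1 * 1 := by linarith
      _ ≤ C1 * (C2 * (a ^ ε * ell a ^ B.2)) := by gcongr
      _ ≤ _ := by
        have : 0 < C3 * (a ^ ε * ell a ^ B.2) := by positivity
        nlinarith
  · have e3 := h3 (a / t) ((one_le_div ht).2 hta)
    have e4 := ell_ratio B.2 ht ha0
    rw [Real.div_rpow ha0.le ht.le] at e3
    calc t ^ ε * ell t ^ B.2 ≤ t ^ ε * (C3 * (a ^ ε / t ^ ε) * ell a ^ B.2) := by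
          gcongr; exact e4.trans (by gcongr)
      _ = C3 * (a ^ ε * ell a ^ B.2) := by field_simp
      _ ≤ _ := by
        have : 0 < C1 * C2 * (a ^ ε * ell a ^ B.2) := by positivity
        nlinarith

lemma rearr_antitone (f : ℝ → ℝ≥0∞) : Antitone (rearr μI f) := by
  intro x y hxy
  apply sInf_le_sInf
  intro l hl
  exact le_trans hl (ENNReal.ofReal_le_ofReal hxy)

lemma rearr_tail {F : ℝ → ℝ≥0∞} (hF : Antitone F) (a t : ℝ) :
    rearr μI ((Set.Ioi a).indicator fun t => F t) t ≤ F (t + a) := by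
  apply sInf_le
  show μI _ ≤ _
  calc μI {x | F (t + a) < (Set.Ioi a).indicator (fun t => F t) x}
      ≤ volume {x | F (t + a) < (Set.Ioi a).indicator (fun t => F t) x} :=
        Measure.restrict_apply_le _ _
    _ ≤ volume (Ioo a (t + a)) := by
        apply measure_mono
        intro x hx
        simp only [mem_ofPred_eq, indicator] at hx
        split_ifs at hx with h
        · refine ⟨h, ?_⟩
          by_contra! h'
          exact absurd (hF h') (not_le.2 hx)
        · simp at hx
    _ = ENNReal.ofReal t := by rw [Real.volume_Ioo]; ring_nf

lemma weight_near (e α : ℝ) : ∃ c : ℝ, 0 < c ∧ ∀ t, 2 ≤ t → ∀ u, t / 2 < u → u < t →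
    c * (t ^ e * ell t ^ α) ≤ u ^ e * ell u ^ α := by
  refine ⟨((2:ℝ) ^ |e| * 2 ^ |α|)⁻¹, by positivity, fun t ht u hu hut => ?_⟩
  have hu1 : 1 < u := by linarith
  have hu0 : 0 < u := by linarith
  have ht0 : 0 < t := by linarith
  have key : ∀ x y b : ℝ, 0 < x → x ≤ y → y ≤ 2 * x → y ^ b ≤ 2 ^ |b| * x ^ b := by
    intro x y b hx hxy hyx
    have hy : 0 < y := by linarith
    rcases le_or_gt 0 b with hb | hb
    · rw [abs_of_nonneg hb, ← Real.mul_rpow (by norm_num) hx.le]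
      exact Real.rpow_le_rpow hy.le hyx hb
    · have h1 : y ^ b ≤ x ^ b := Real.rpow_le_rpow_of_nonpos hx hxy hb.le
      have h2 : (1:ℝ) ≤ 2 ^ |b| := Real.one_le_rpow (by norm_num) (abs_nonneg _)
      have h3 : 0 < x ^ b := Real.rpow_pos_of_pos hx _
      nlinarith
  have k1 := key u t e hu0 hut.le (by linarith)
  have hl : ell t ≤ 2 * ell u := by
    have h1 : ell t ≤ ell (2 * u) := ell_mono (by linarith) (by linarith)
    rw [ell_of_one_le (by linarith : 1 ≤ 2 * u), Real.log_mul (by norm_num) hu0.ne'] at h1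
    rw [ell_of_one_le hu1.le]
    linarith [Real.log_two_lt_d9, Real.log_nonneg hu1.le]
  have k2 := key (ell u) (ell t) α (ell_pos u) (ell_mono hu1.le hut.le) hl
  rw [inv_mul_le_iff₀ (by positivity)]
  have := mul_le_mul k1 k2 (Real.rpow_pos_of_pos (ell_pos t) _).le
    (by have := Real.rpow_pos_of_pos hu0 e; positivity)
  linarith

lemma pw_bound (P : ℝ) {q : ℝ≥0∞} (hq : 1 ≤ q) (A : ℝ × ℝ) :
    ∃ C : ℝ, 0 < C ∧ ∀ F : ℝ → ℝ≥0∞, Antitone F →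
      lqNorm q (fun t => ENNReal.ofReal (t ^ (P - q.toReal⁻¹) * ellA A t) * F t) ≤ 1 →
      ∀ t, 2 ≤ t → F t ≤ ENNReal.ofReal (C * (t ^ (-P) * ell t ^ (-A.2))) := by
  obtain ⟨c, hc, hw⟩ := weight_near (P - q.toReal⁻¹) A.2
  refine ⟨2 ^ q.toReal⁻¹ / c, by positivity, fun F hF hn t ht => ?_⟩
  have ht0 : 0 < t := by linarith
  have pe := ell_pos t
  have p1 : 0 < t ^ (P - q.toReal⁻¹) * ell t ^ A.2 := by positivity
  have hlow : ∀ u ∈ Ioo (t/2) t, ENNReal.ofReal (c * (t ^ (P - q.toReal⁻¹) * ell t ^ A.2)) * F t ≤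
      ENNReal.ofReal (u ^ (P - q.toReal⁻¹) * ellA A u) * F u := by
    intro u hu
    have : ¬ u ≤ 1 := by have := hu.1; push Not; linarith
    rw [ellA, if_neg this]
    exact mul_le_mul' (ENNReal.ofReal_le_ofReal (hw t ht u hu.1 hu.2)) (hF hu.2.le)
  have hsub : Ioo (t/2) t ⊆ Ioi 0 := fun u hu => by have := hu.1; simp only [mem_Ioi]; linarith
  have main : ENNReal.ofReal (c * (t ^ (P - q.toReal⁻¹) * ell t ^ A.2)) * F t *
      ENNReal.ofReal ((t/2) ^ q.toReal⁻¹) ≤ 1 := by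
    unfold lqNorm at hn
    split_ifs at hn with hqi
    · subst hqi
      simp only [ENNReal.toReal_top, inv_zero, Real.rpow_zero, ENNReal.ofReal_one, mul_one, sub_zero] at *
      have hae := ENNReal.ae_le_essSup (μ := μI)
        (fun t => ENNReal.ofReal (t ^ P * ellA A t) * F t)
      by_contra! hcon
      have hz : μI (Ioo (t/2) t) = 0 := by
        refine measure_mono_null ?_ (ae_iff.1 hae)
        intro u hu
        simp only [mem_ofPred_eq, not_le]
        exact hn.trans_lt (hcon.trans_le (hlow u hu))
      rw [μI, Measure.restrict_apply measurableSet_Ioo, inter_eq_left.2 hsub, Real.volume_Ioo] at hz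
      simp at hz; linarith
    · have hQ : 0 < q.toReal := ENNReal.toReal_pos (by positivity) hqi
      have hn' := (ENNReal.rpow_le_rpow_iff (inv_pos.2 hQ)).1 (hn.trans_eq (ENNReal.one_rpow _).symm)
      rw [← ENNReal.rpow_le_rpow_iff hQ, ENNReal.one_rpow]
      refine le_trans ?_ hn'
      rw [ENNReal.mul_rpow_of_nonneg _ _ hQ.le, ENNReal.ofReal_rpow_of_nonneg (by positivity) hQ.le,
        ← Real.rpow_mul (by positivity), inv_mul_cancel₀ hQ.ne', Real.rpow_one]
      calc _ = ∫⁻ u in Ioo (t/2) t, (ENNReal.ofReal (c * (t ^ (P - q.toReal⁻¹) * ell t ^ A.2)) * F t) ^ q.toReal := by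
            rw [setLIntegral_const, Real.volume_Ioo]; congr 2; ring
        _ ≤ ∫⁻ u in Ioo (t/2) t, (ENNReal.ofReal (u ^ (P - q.toReal⁻¹) * ellA A u) * F u) ^ q.toReal := by
            apply setLIntegral_mono' measurableSet_Ioo
            intro u hu
            exact ENNReal.rpow_le_rpow (hlow u hu) hQ.le
        _ ≤ _ := lintegral_mono_set hsub
  have hre : c * (t ^ (P - q.toReal⁻¹) * ell t ^ A.2) * (t/2) ^ q.toReal⁻¹ =
      (2 ^ q.toReal⁻¹ / c * (t ^ (-P) * ell t ^ (-A.2)))⁻¹ := by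
    rw [Real.rpow_sub ht0, Real.rpow_neg ht0.le, Real.rpow_neg pe.le, Real.div_rpow ht0.le (by norm_num)]
    field_simp
  have hpos : 0 < 2 ^ q.toReal⁻¹ / c * (t ^ (-P) * ell t ^ (-A.2)) := by positivity
  rw [mul_right_comm, ← ENNReal.ofReal_mul (by positivity), hre, ENNReal.ofReal_inv_of_pos hpos] at main
  rwa [ENNReal.inv_mul_le_iff (by simpa using hpos) ENNReal.ofReal_ne_top, mul_one] at main

lemma te_rpow {T E : ℝ} (hT : 0 < T) (hE : 0 < E) (x y z : ℝ) :
    (T ^ x * E ^ y) ^ z = T ^ (x * z) * E ^ (y * z) := by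
  rw [Real.mul_rpow (by positivity) (by positivity), ← Real.rpow_mul hT.le, ← Real.rpow_mul hE.le]

lemma te_mul {T E : ℝ} (hT : 0 < T) (hE : 0 < E) (x y x' y' : ℝ) :
    (T ^ x * E ^ y) * (T ^ x' * E ^ y') = T ^ (x + x') * E ^ (y + y') := by
  rw [Real.rpow_add hT, Real.rpow_add hE]; ring

lemma tendsto_ell : Tendsto ell atTop atTop := by
  apply tendsto_atTop_mono (f := Real.log) _ Real.tendsto_log_atTop
  intro t; unfold ell; linarith [le_abs_self (Real.log t)]

lemma tendsto_ell_rpow (C : ℝ) {δ : ℝ} (hδ : δ < 0) :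
    Tendsto (fun a => ENNReal.ofReal (C * ell a ^ δ)) atTop (nhds 0) := by
  have h := (tendsto_rpow_neg_atTop (neg_pos.2 hδ)).comp tendsto_ell
  have h2 := ENNReal.tendsto_ofReal (h.const_mul C)
  simpa using h2

lemma tendsto_rpow_zero {G : ℝ → ℝ≥0∞} (hG : Tendsto G atTop (nhds 0)) {r : ℝ} (hr : 0 < r) :
    Tendsto (fun a => G a ^ r) atTop (nhds 0) := by
  have := (ENNReal.continuous_rpow_const (y := r)).tendsto 0
  rw [ENNReal.zero_rpow_of_pos hr] at this
  exact this.comp hG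

lemma lint_rpow {r a : ℝ} (hr : 0 < r) (ha : 0 < a) :
    ∫⁻ t in Ioc 0 a, ENNReal.ofReal (t ^ (r - 1)) = ENNReal.ofReal (a ^ r / r) := by
  have hi := (intervalIntegral.intervalIntegrable_rpow' (a := 0) (b := a) (by linarith : -1 < r - 1))
  rw [intervalIntegrable_iff_integrableOn_Ioc_of_le ha.le] at hi
  rw [← ofReal_integral_eq_lintegral_ofReal hi, ← intervalIntegral.integral_of_le ha.le,
    integral_rpow (Or.inl (by linarith))]
  · simp [Real.zero_rpow hr.ne']
  · filter_upwards [self_mem_ae_restrict measurableSet_Ioc] with t ht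
    exact Real.rpow_nonneg ht.1.le _

lemma lint_tail {κ a : ℝ} (hκ : 1 < κ) (ha : 1 ≤ a) :
    ∫⁻ t in Ioi a, ENNReal.ofReal (t ^ (-1 : ℝ) * ell t ^ (-κ)) =
      ENNReal.ofReal ((κ - 1)⁻¹ * ell a ^ (1 - κ)) := by
  set g : ℝ → ℝ := fun t => -(κ - 1)⁻¹ * (1 + Real.log t) ^ (1 - κ) with hg
  have hd : ∀ x, 1 ≤ x → HasDerivAt g (x ^ (-1 : ℝ) * (1 + Real.log x) ^ (-κ)) x := by
    intro x hx
    have hx0 : 0 < x := by linarith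
    have hl : 0 < 1 + Real.log x := by linarith [Real.log_nonneg hx]
    have h1 := ((Real.hasDerivAt_log hx0.ne').const_add 1).rpow_const (p := 1 - κ) (Or.inl hl.ne')
    refine (h1.const_mul (-(κ - 1)⁻¹)).congr_deriv ?_
    rw [Real.rpow_neg_one, show 1 - κ - 1 = -κ by ring]
    have : κ - 1 ≠ 0 := by linarith
    field_simp
    ring
  have hnn : ∀ x ∈ Ioi a, 0 ≤ x ^ (-1 : ℝ) * (1 + Real.log x) ^ (-κ) := by
    intro x hx
    have hx1 : 1 ≤ x := ha.trans (le_of_lt hx)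
    have hl : 0 < 1 + Real.log x := by linarith [Real.log_nonneg hx1]
    have : 0 < x := by linarith
    positivity
  have hlim : Tendsto g atTop (nhds 0) := by
    have h := (tendsto_rpow_neg_atTop (sub_pos.2 hκ)).comp
      (tendsto_atTop_add_const_left atTop 1 Real.tendsto_log_atTop)
    have h2 := h.const_mul (-(κ - 1)⁻¹)
    simpa [hg, Function.comp_def] using h2
  have hc : ContinuousWithinAt g (Ici a) a := (hd a ha).continuousAt.continuousWithinAt
  have hd' : ∀ x ∈ Ioi a, HasDerivAt g (x ^ (-1 : ℝ) * (1 + Real.log x) ^ (-κ)) x :=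
    fun x hx => hd x (ha.trans (le_of_lt hx))
  have hint := integral_Ioi_of_hasDerivAt_of_nonneg hc hd' hnn hlim
  have hI := integrableOn_Ioi_deriv_of_nonneg hc hd' hnn hlim
  calc _ = ∫⁻ t in Ioi a, ENNReal.ofReal (t ^ (-1 : ℝ) * (1 + Real.log t) ^ (-κ)) := by
        apply setLIntegral_congr_fun measurableSet_Ioi
        intro t ht
        simp only
        rw [ell_of_one_le (ha.trans (le_of_lt ht))]
    _ = _ := by
        rw [← ofReal_integral_eq_lintegral_ofReal hI, hint, ell_of_one_le ha]
        · simp [hg]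
        · filter_upwards [self_mem_ae_restrict measurableSet_Ioi] with t ht
          exact hnn t ht

lemma near_part {P S : ℝ} (hP : 0 < P) (hS : 0 < S) (B : ℝ × ℝ) :
    ∃ C : ℝ, 0 < C ∧ ∀ a, 1 ≤ a → ∀ y : ℝ≥0∞,
      ∫⁻ t in Ioc 0 a, (ENNReal.ofReal (t ^ (P - S⁻¹) * ellA B t) * y) ^ S ≤
        (ENNReal.ofReal (C * (a ^ P * ell a ^ B.2)) * y) ^ S := by
  obtain ⟨C0, hC0, h0⟩ := ell_near B (half_pos hP)
  set r := P * S / 2 with hr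
  have hr0 : 0 < r := by positivity
  refine ⟨C0 * r⁻¹ ^ S⁻¹, by positivity, fun a ha y => ?_⟩
  have ha0 : 0 < a := by linarith
  have pa := ell_pos a
  set K := C0 * (a ^ (P/2) * ell a ^ B.2) with hK
  have hK0 : 0 < K := by positivity
  calc _ ≤ ∫⁻ t in Ioc 0 a, ENNReal.ofReal (t ^ (r - 1)) * (ENNReal.ofReal K * y) ^ S := by
        apply setLIntegral_mono' measurableSet_Ioc
        intro t ht
        have ht0 : 0 < t := ht.1
        have e1 : t ^ (P - S⁻¹) * ellA B t ≤ t ^ (P / 2 - S⁻¹) * K := by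
          have : t ^ (P - S⁻¹) = t ^ (P/2 - S⁻¹) * t ^ (P/2) := by
            rw [← Real.rpow_add ht0]; ring_nf
          rw [this, mul_assoc]
          exact mul_le_mul_of_nonneg_left (h0 a ha t ht0 ht.2) (by positivity)
        calc _ ≤ (ENNReal.ofReal (t ^ (P / 2 - S⁻¹) * K) * y) ^ S := by gcongr
          _ = _ := by
            rw [ENNReal.ofReal_mul (by positivity), mul_assoc, ENNReal.mul_rpow_of_nonneg _ _ hS.le,
              ENNReal.ofReal_rpow_of_nonneg (by positivity) hS.le, ← Real.rpow_mul ht0.le]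
            congr 4
            rw [hr]; field_simp
    _ = ENNReal.ofReal (a ^ r / r) * (ENNReal.ofReal K * y) ^ S := by
        rw [lintegral_mul_const, lint_rpow hr0 ha0]
        exact ENNReal.measurable_ofReal.comp (measurable_id.pow_const _)
    _ = (ENNReal.ofReal ((a ^ r / r) ^ S⁻¹) * (ENNReal.ofReal K * y)) ^ S := by
        rw [ENNReal.mul_rpow_of_nonneg (ENNReal.ofReal ((a ^ r / r) ^ S⁻¹)) _ hS.le,
          ENNReal.ofReal_rpow_of_nonneg (x := (a ^ r / r) ^ S⁻¹) (by positivity) hS.le,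
          ← Real.rpow_mul (by positivity),
          inv_mul_cancel₀ hS.ne', Real.rpow_one]
    _ = _ := by
        rw [← mul_assoc, ← ENNReal.ofReal_mul (by positivity)]
        congr 3
        rw [div_eq_mul_inv, Real.mul_rpow (by positivity) (by positivity), ← Real.rpow_mul ha0.le,
          show r * S⁻¹ = P / 2 by rw [hr]; field_simp, hK]
        have : a ^ P = a ^ (P/2) * a ^ (P/2) := by rw [← Real.rpow_add ha0]; ring_nf
        rw [this]; ring

lemma far_part {P S : ℝ} (hS : 0 < S) {q : ℝ≥0∞} (hq : 1 ≤ q) (A B : ℝ × ℝ)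
    (hcond : B.2 + max (S⁻¹ - q.toReal⁻¹) 0 < A.2) :
    ∃ G : ℝ → ℝ≥0∞, Tendsto G atTop (nhds 0) ∧ ∀ F : ℝ → ℝ≥0∞, Antitone F →
      lqNorm q (fun t => ENNReal.ofReal (t ^ (P - q.toReal⁻¹) * ellA A t) * F t) ≤ 1 →
      ∀ a, 2 ≤ a →
        ∫⁻ t in Ioi a, (ENNReal.ofReal (t ^ (P - S⁻¹) * ellA B t) * F t) ^ S ≤ G a := by
  obtain ⟨C, hC, hpw⟩ := pw_bound P hq A
  have hc1 : B.2 < A.2 := by linarith [le_max_right (S⁻¹ - q.toReal⁻¹) 0]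
  have hc2 : S⁻¹ - q.toReal⁻¹ < A.2 - B.2 := by linarith [le_max_left (S⁻¹ - q.toReal⁻¹) 0]
  have hellB : ∀ (D : ℝ × ℝ) (a t : ℝ), 2 ≤ a → t ∈ Ioi a → ellA D t = ell t ^ D.2 := by
    intro D a t ha ht
    rw [ellA, if_neg]
    have : a < t := ht
    push Not; linarith
  by_cases hqi : q = ∞
  · subst hqi
    have hκ : 1 < (A.2 - B.2) * S := by
      simp only [ENNReal.toReal_top, inv_zero, sub_zero] at hc2
      rwa [inv_lt_iff_one_lt_mul₀ hS] at hc2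
    refine ⟨fun a => ENNReal.ofReal (C ^ S) * ENNReal.ofReal (((A.2 - B.2) * S - 1)⁻¹ * ell a ^ (1 - (A.2 - B.2) * S)), ?_, ?_⟩
    · simpa using ENNReal.Tendsto.const_mul (a := ENNReal.ofReal (C ^ S)) (tendsto_ell_rpow (((A.2 - B.2) * S - 1)⁻¹) (by linarith : 1 - (A.2 - B.2) * S < 0)) (Or.inr ENNReal.ofReal_ne_top)
    · intro F hF hn a ha
      beta_reduce
      rw [← lint_tail hκ (by linarith), ← lintegral_const_mul' _ _ ENNReal.ofReal_ne_top]
      apply setLIntegral_mono' measurableSet_Ioi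
      intro t ht
      have hta : a < t := ht
      have ht0 : 0 < t := by linarith
      have pe := ell_pos t
      rw [hellB B a t ha ht]
      calc _ ≤ (ENNReal.ofReal (t ^ (P - S⁻¹) * ell t ^ B.2) * ENNReal.ofReal (C * (t ^ (-P) * ell t ^ (-A.2)))) ^ S := by
            gcongr; exact hpw F hF hn t (by linarith)
        _ = _ := by
          rw [← ENNReal.ofReal_mul (by positivity), ENNReal.ofReal_rpow_of_nonneg (by positivity) hS.le,
            ← ENNReal.ofReal_mul (by positivity), mul_left_comm, te_mul ht0 pe,
            Real.mul_rpow hC.le (by positivity), te_rpow ht0 pe]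
          congr 4
          · field_simp; ring
          · ring
  have hQ : 0 < q.toReal := ENNReal.toReal_pos (by positivity) hqi
  set Q := q.toReal with hQdef
  have hnorm : ∀ F : ℝ → ℝ≥0∞, lqNorm q (fun t => ENNReal.ofReal (t ^ (P - Q⁻¹) * ellA A t) * F t) ≤ 1 →
      ∀ a, 2 ≤ a → ∫⁻ t in Ioi a, (ENNReal.ofReal (t ^ (P - Q⁻¹) * ell t ^ A.2) * F t) ^ Q ≤ 1 := by
    intro F hn a ha
    rw [lqNorm, if_neg hqi] at hn
    have hn' := (ENNReal.rpow_le_rpow_iff (inv_pos.2 hQ)).1 (hn.trans_eq (ENNReal.one_rpow _).symm)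
    refine le_trans ?_ hn'
    refine le_trans ?_ (lintegral_mono_set (Ioi_subset_Ioi (by linarith : (0:ℝ) ≤ a)))
    apply setLIntegral_mono' measurableSet_Ioi
    intro t ht
    rw [hellB A a t ha ht]
  rcases le_or_gt Q S with hQS | hQS
  · refine ⟨fun a => ENNReal.ofReal (C ^ (S - Q) * ell a ^ ((B.2 - A.2) * S)),
      tendsto_ell_rpow _ (by nlinarith), ?_⟩
    intro F hF hn a ha
    calc _ ≤ ∫⁻ t in Ioi a, ENNReal.ofReal (C ^ (S - Q) * ell a ^ ((B.2 - A.2) * S)) *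
          (ENNReal.ofReal (t ^ (P - Q⁻¹) * ell t ^ A.2) * F t) ^ Q := by
          apply setLIntegral_mono' measurableSet_Ioi
          intro t ht
          have hta : a < t := ht
          have ht0 : 0 < t := by linarith
          have pe := ell_pos t
          rw [hellB B a t ha ht]
          have hsplit : F t ^ S ≤ ENNReal.ofReal ((C * (t ^ (-P) * ell t ^ (-A.2))) ^ (S - Q)) * F t ^ Q := by
            calc F t ^ S = F t ^ (S - Q) * F t ^ Q := by
                  rw [← ENNReal.rpow_add_of_nonneg _ _ (by linarith) hQ.le]; ring_nf
              _ ≤ _ := by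
                  rw [← ENNReal.ofReal_rpow_of_nonneg (by positivity) (by linarith)]
                  gcongr
                  exact hpw F hF hn t (by linarith)
          have hmono : ell t ^ ((B.2 - A.2) * S) ≤ ell a ^ ((B.2 - A.2) * S) :=
            Real.rpow_le_rpow_of_nonpos (ell_pos a) (ell_mono (by linarith) hta.le) (by nlinarith)
          calc _ = ENNReal.ofReal ((t ^ (P - S⁻¹) * ell t ^ B.2) ^ S) * F t ^ S := by
                rw [ENNReal.mul_rpow_of_nonneg _ _ hS.le, ENNReal.ofReal_rpow_of_nonneg (by positivity) hS.le]
            _ ≤ ENNReal.ofReal ((t ^ (P - S⁻¹) * ell t ^ B.2) ^ S) *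
                (ENNReal.ofReal ((C * (t ^ (-P) * ell t ^ (-A.2))) ^ (S - Q)) * F t ^ Q) := by gcongr
            _ = ENNReal.ofReal (C ^ (S - Q) * ell t ^ ((B.2 - A.2) * S)) *
                (ENNReal.ofReal (t ^ (P - Q⁻¹) * ell t ^ A.2) * F t) ^ Q := by
                rw [ENNReal.mul_rpow_of_nonneg _ _ hQ.le, ENNReal.ofReal_rpow_of_nonneg (by positivity) hQ.le,
                  ← mul_assoc (ENNReal.ofReal _) (ENNReal.ofReal _), ← mul_assoc (ENNReal.ofReal _) (ENNReal.ofReal _),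
                  ← ENNReal.ofReal_mul (by positivity), ← ENNReal.ofReal_mul (by positivity)]
                congr 2
                rw [Real.mul_rpow hC.le (by positivity), te_rpow ht0 pe, te_rpow ht0 pe, te_rpow ht0 pe,
                  mul_left_comm, te_mul ht0 pe, mul_assoc, mul_left_comm (ell t ^ _), ← Real.rpow_add pe]
                congr 3
                · field_simp; ring
                · ring
            _ ≤ _ := by gcongr
      _ = ENNReal.ofReal (C ^ (S - Q) * ell a ^ ((B.2 - A.2) * S)) *
          ∫⁻ t in Ioi a, (ENNReal.ofReal (t ^ (P - Q⁻¹) * ell t ^ A.2) * F t) ^ Q :=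
          lintegral_const_mul' _ _ ENNReal.ofReal_ne_top
      _ ≤ _ := by
          calc _ ≤ ENNReal.ofReal (C ^ (S - Q) * ell a ^ ((B.2 - A.2) * S)) * 1 := by
                gcongr; exact hnorm F hn a ha
            _ = _ := mul_one _
  · set R := (S⁻¹ - Q⁻¹)⁻¹ with hR
    have hd : 0 < S⁻¹ - Q⁻¹ := sub_pos.2 (inv_strictAnti₀ hS hQS)
    have hR0 : 0 < R := inv_pos.2 hd
    have hκ : 1 < (A.2 - B.2) * R := by
      rw [hR, ← div_eq_mul_inv, one_lt_div hd]; exact hc2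
    refine ⟨fun a => (ENNReal.ofReal (((A.2 - B.2) * R - 1)⁻¹ * ell a ^ (1 - (A.2 - B.2) * R)) ^ (1 / R)) ^ S,
      tendsto_rpow_zero (tendsto_rpow_zero (tendsto_ell_rpow _ (by linarith)) (by positivity)) hS, ?_⟩
    intro F hF hn a ha
    have mell : Measurable ell := by
      unfold ell; exact measurable_const.add (Real.measurable_log.abs)
    have H := ENNReal.lintegral_Lp_mul_le_Lq_mul_Lr (p := S) (q := Q) (r := R) hS hQS
      (by rw [hR, one_div, one_div, one_div, inv_inv]; ring) (volume.restrict (Ioi a))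
      (f := fun t => ENNReal.ofReal (t ^ (P - Q⁻¹) * ell t ^ A.2) * F t)
      (g := fun t => ENNReal.ofReal (t ^ (Q⁻¹ - S⁻¹) * ell t ^ (B.2 - A.2)))
      (((ENNReal.measurable_ofReal.comp ((measurable_id.pow_const _).mul (mell.pow_const _))).mul
        hF.measurable).aemeasurable)
      ((ENNReal.measurable_ofReal.comp ((measurable_id.pow_const _).mul (mell.pow_const _))).aemeasurable)
    have e1 : ∫⁻ t in Ioi a, (ENNReal.ofReal (t ^ (P - S⁻¹) * ellA B t) * F t) ^ S =
        ∫⁻ t in Ioi a, ((fun t => ENNReal.ofReal (t ^ (P - Q⁻¹) * ell t ^ A.2) * F t) *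
          (fun t => ENNReal.ofReal (t ^ (Q⁻¹ - S⁻¹) * ell t ^ (B.2 - A.2)))) t ^ S := by
      apply setLIntegral_congr_fun measurableSet_Ioi
      intro t ht
      have hta : a < t := ht
      have ht0 : 0 < t := by linarith
      have pe := ell_pos t
      simp only [Pi.mul_apply]
      rw [hellB B a t ha ht, mul_right_comm, ← ENNReal.ofReal_mul (by positivity), te_mul ht0 pe]
      ring_nf
    have e2 : ∫⁻ t in Ioi a, ENNReal.ofReal (t ^ (Q⁻¹ - S⁻¹) * ell t ^ (B.2 - A.2)) ^ R =
        ENNReal.ofReal (((A.2 - B.2) * R - 1)⁻¹ * ell a ^ (1 - (A.2 - B.2) * R)) := by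
      rw [← lint_tail hκ (by linarith)]
      apply setLIntegral_congr_fun measurableSet_Ioi
      intro t ht
      have hta : a < t := ht
      have ht0 : 0 < t := by linarith
      have pe := ell_pos t
      simp only
      rw [ENNReal.ofReal_rpow_of_nonneg (by positivity) hR0.le, te_rpow ht0 pe]
      congr 3
      · rw [hR, ← neg_sub, neg_mul, mul_inv_cancel₀ hd.ne']
      · ring
    rw [← e1, e2] at H
    have H2 : (∫⁻ t in Ioi a, (ENNReal.ofReal (t ^ (P - Q⁻¹) * ell t ^ A.2) * F t) ^ Q) ^ (1 / Q) ≤ 1 :=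
      ENNReal.rpow_le_one (hnorm F hn a ha) (by positivity)
    have H3 := H.trans (mul_le_mul_left H2 _)
    rw [one_mul] at H3
    have H4 := ENNReal.rpow_le_rpow H3 hS.le
    rwa [← ENNReal.rpow_mul, one_div_mul_cancel hS.ne', ENNReal.rpow_one] at H4

lemma adm_facts {p q : ℝ≥0∞} {A : ℝ × ℝ} (h : LZAdmissible p q A) (hp : p ≠ ∞) :
    0 < p.toReal⁻¹ ∧ 1 ≤ q := by
  rcases h with ⟨h1, h2, -⟩ | ⟨h1, h2, h3⟩ | ⟨h1, -⟩ | ⟨h1, -⟩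
  · subst h1 h2; simp
  · exact ⟨inv_pos.2 (ENNReal.toReal_pos (zero_lt_one.trans h1).ne' hp), h3⟩
  · exact absurd h1 hp
  · exact absurd h1 hp

lemma unif_bound {P : ℝ} (hP : 0 < P) {q s : ℝ≥0∞} (hq : 1 ≤ q) (hs : 1 ≤ s) (A B : ℝ × ℝ)
    (hcond : B.2 + max (s.toReal⁻¹ - q.toReal⁻¹) 0 < A.2) :
    ∃ G : ℝ → ℝ≥0∞, Tendsto G atTop (nhds 0) ∧ ∀ F : ℝ → ℝ≥0∞, Antitone F →
      lqNorm q (fun t => ENNReal.ofReal (t ^ (P - q.toReal⁻¹) * ellA A t) * F t) ≤ 1 →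
      ∀ a, 2 ≤ a →
        lqNorm s (fun t => ENNReal.ofReal (t ^ (P - s.toReal⁻¹) * ellA B t) *
          rearr μI ((Set.Ioi a).indicator fun t => F t) t) ≤ G a := by
  obtain ⟨C, hC, hpw⟩ := pw_bound P hq A
  have hc1 : B.2 < A.2 := by linarith [le_max_right (s.toReal⁻¹ - q.toReal⁻¹) 0]
  by_cases hsi : s = ∞
  · subst hsi
    obtain ⟨C0, hC0, h0⟩ := ell_near B hP
    refine ⟨fun a => ENNReal.ofReal ((C0 * C + C) * ell a ^ (B.2 - A.2)),
      tendsto_ell_rpow _ (by linarith), ?_⟩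
    intro F hF hn a ha
    have ha0 : 0 < a := by linarith
    have pa := ell_pos a
    rw [lqNorm, if_pos rfl]
    refine essSup_le_of_ae_le _ ?_
    filter_upwards [self_mem_ae_restrict (measurableSet_Ioi (a := (0:ℝ)))] with t ht
    have ht0 : 0 < t := ht
    have pe := ell_pos t
    simp only [ENNReal.toReal_top, inv_zero, sub_zero]
    have hr := rearr_tail hF a t
    have pX : 0 < ell a ^ (B.2 - A.2) := Real.rpow_pos_of_pos pa _
    rcases le_or_gt t a with hta | hta
    · calc _ ≤ ENNReal.ofReal (C0 * (a ^ P * ell a ^ B.2)) * ENNReal.ofReal (C * (a ^ (-P) * ell a ^ (-A.2))) := by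
            refine mul_le_mul' (ENNReal.ofReal_le_ofReal (h0 a (by linarith) t ht0 hta)) ?_
            exact hr.trans ((hF (by linarith : a ≤ t + a)).trans (hpw F hF hn a ha))
        _ = ENNReal.ofReal (C0 * C * ell a ^ (B.2 - A.2)) := by
            rw [← ENNReal.ofReal_mul (by positivity), mul_mul_mul_comm, te_mul ha0 pa]
            simp [sub_eq_add_neg]
        _ ≤ _ := by gcongr; linarith
    · have h1t : ¬ t ≤ 1 := by push Not; linarith
      calc _ ≤ ENNReal.ofReal (t ^ P * ell t ^ B.2) * ENNReal.ofReal (C * (t ^ (-P) * ell t ^ (-A.2))) := by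
            rw [ellA, if_neg h1t]
            refine mul_le_mul' le_rfl ?_
            exact hr.trans ((hF (by linarith : t ≤ t + a)).trans (hpw F hF hn t (by linarith)))
        _ = ENNReal.ofReal (C * ell t ^ (B.2 - A.2)) := by
            rw [← ENNReal.ofReal_mul (by positivity), mul_left_comm, te_mul ht0 pe]
            simp [sub_eq_add_neg]
        _ ≤ _ := by
            apply ENNReal.ofReal_le_ofReal
            have hmono : ell t ^ (B.2 - A.2) ≤ ell a ^ (B.2 - A.2) :=
              Real.rpow_le_rpow_of_nonpos pa (ell_mono (by linarith) hta.le) (by linarith)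
            have : 0 < C0 * C := by positivity
            nlinarith
  · have hS : 0 < s.toReal := ENNReal.toReal_pos (by positivity) hsi
    obtain ⟨C0, hC0, h0⟩ := near_part hP hS B
    obtain ⟨G, hG, hfar⟩ := far_part (P := P) hS hq A B hcond
    refine ⟨fun a => (ENNReal.ofReal (C0 * C * ell a ^ (B.2 - A.2)) ^ s.toReal + G a) ^ s.toReal⁻¹, ?_, ?_⟩
    · apply tendsto_rpow_zero _ (inv_pos.2 hS)
      simpa using (tendsto_rpow_zero (tendsto_ell_rpow (C0 * C) (by linarith : B.2 - A.2 < 0)) hS).add hG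
    · intro F hF hn a ha
      have ha0 : 0 < a := by linarith
      have pa := ell_pos a
      rw [lqNorm, if_neg hsi]
      beta_reduce
      gcongr
      rw [← Ioc_union_Ioi_eq_Ioi ha0.le]
      refine (lintegral_union_le _ _ _).trans (add_le_add ?_ ?_)
      · calc _ ≤ ∫⁻ t in Ioc 0 a, (ENNReal.ofReal (t ^ (P - s.toReal⁻¹) * ellA B t) * F a) ^ s.toReal := by
              apply setLIntegral_mono' measurableSet_Ioc
              intro t ht
              gcongr
              exact (rearr_tail hF a t).trans (hF (by linarith [ht.1]))
          _ ≤ _ := h0 a (by linarith) (F a)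
          _ ≤ (ENNReal.ofReal (C0 * (a ^ P * ell a ^ B.2)) *
                ENNReal.ofReal (C * (a ^ (-P) * ell a ^ (-A.2)))) ^ s.toReal := by
              gcongr; exact hpw F hF hn a ha
          _ = _ := by
            rw [← ENNReal.ofReal_mul (by positivity), mul_mul_mul_comm, te_mul ha0 pa]
            simp [sub_eq_add_neg]
      · refine le_trans ?_ (hfar F hF hn a ha)
        apply setLIntegral_mono' measurableSet_Ioi
        intro t ht
        gcongr
        exact (rearr_tail hF a t).trans (hF (by linarith))

/-- for `p = r < ∞` and `β_∞ + max{1/s - 1/q, 0} < α_∞`, the tails are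
uniformly small. -/
theorem lz_tail_vanishes_same_p (p q s : ℝ≥0∞) (A B : ℝ × ℝ)
    (hA : LZAdmissible p q A) (hB : LZAdmissible p s B) (hp : p ≠ ∞)
    (hcond : B.2 + max (s.toReal⁻¹ - q.toReal⁻¹) 0 < A.2) :
    Tendsto (fun a : ℝ =>
        ⨆ (f : ℝ → ℝ≥0∞) (_ : Measurable f) (_ : lzNorm p q A f ≤ 1),
          lzNorm p s B ((Set.Ioi a).indicator fun t => rearr μI f t))
      atTop (nhds 0) := by
  obtain ⟨hP, hq⟩ := adm_facts hA hp
  obtain ⟨-, hs⟩ := adm_facts hB hp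
  obtain ⟨G, hG, hb⟩ := unif_bound hP hq hs A B hcond
  refine tendsto_of_tendsto_of_tendsto_of_le_of_le' tendsto_const_nhds hG
    (Eventually.of_forall fun _ => zero_le) ?_
  filter_upwards [eventually_ge_atTop 2] with a ha
  refine iSup_le fun f => iSup_le fun _ => iSup_le fun hf => ?_
  exact hb (rearr μI f) (rearr_antitone f) hf a ha

end
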